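/- In the first-price auction, for every n, m, partition B_u, B_v, values {v i j} and every equilibrium strategy profile: Σ_{i ∈ B_v} E[val i] + Σ over all bidders i and all auctions j with rw(j) ∈ B_v of E[p i j] ≥ Σ over all auctions j with rw(j) ∈ B_v of max_i v i j. -/

import Mathlib

open MeasureTheory Finset
open scoped Classical

namespace FPA

variable {n m : ℕ}

/-- Bidder `i` wins auction `j` under bid profile `b`: highest bid, ties broken
in favor of larger value, then smaller index. -/
def Wins (v b : Fin n → Fin m → ℝ) (j : Fin m) (i : Fin n) : Prop :=
  ∀ i', i' ≠ i →
    b i' j < b i j ∨ (b i' j = b i j ∧ (v i' j < v i j ∨ (v i' j = v i j ∧ i < i')))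

/-- Indicator that bidder `i` wins auction `j`. -/
noncomputable def xind (v b : Fin n → Fin m → ℝ) (j : Fin m) (i : Fin n) : ℝ :=
  if Wins v b j i then 1 else 0

noncomputable def valij (v b : Fin n → Fin m → ℝ) (i : Fin n) (j : Fin m) : ℝ :=
  xind v b j i * v i j

noncomputable def payij (v b : Fin n → Fin m → ℝ) (i : Fin n) (j : Fin m) : ℝ :=
  xind v b j i * b i j

/-- Admissible strategy: probability distribution over nonnegative bid vectors
with finite expectations. -/
def Admissible (σ : Measure (Fin m → ℝ)) : Prop :=
  IsProbabilityMeasure σ ∧ (∀ᵐ β ∂σ, ∀ j, 0 ≤ β j) ∧ ∀ j, Integrable (fun β => β j) σ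

noncomputable def EValij (v : Fin n → Fin m → ℝ) (μ : Fin n → Measure (Fin m → ℝ))
    (i : Fin n) (j : Fin m) : ℝ :=
  ∫ b, valij v b i j ∂(Measure.pi μ)

noncomputable def EPayij (v : Fin n → Fin m → ℝ) (μ : Fin n → Measure (Fin m → ℝ))
    (i : Fin n) (j : Fin m) : ℝ :=
  ∫ b, payij v b i j ∂(Measure.pi μ)

noncomputable def EVal (v : Fin n → Fin m → ℝ) (μ : Fin n → Measure (Fin m → ℝ))
    (i : Fin n) : ℝ :=
  ∑ j, EValij v μ i j

noncomputable def EPay (v : Fin n → Fin m → ℝ) (μ : Fin n → Measure (Fin m → ℝ))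
    (i : Fin n) : ℝ :=
  ∑ j, EPayij v μ i j

noncomputable def EUtil (v : Fin n → Fin m → ℝ) (μ : Fin n → Measure (Fin m → ℝ))
    (i : Fin n) : ℝ :=
  EVal v μ i - EPay v μ i

/-- A utility maximizer best responds: no admissible deviation improves expected utility. -/
def UtilBest (v : Fin n → Fin m → ℝ) (μ : Fin n → Measure (Fin m → ℝ)) (i : Fin n) : Prop :=
  ∀ σ, Admissible σ → EUtil v (Function.update μ i σ) i ≤ EUtil v μ i

/-- A value maximizer best responds: its ROI constraint holds and no admissible
deviation satisfying the ROI constraint yields more expected value. -/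
def ValBest (v : Fin n → Fin m → ℝ) (μ : Fin n → Measure (Fin m → ℝ)) (i : Fin n) : Prop :=
  EPay v μ i ≤ EVal v μ i ∧
    ∀ σ, Admissible σ →
      EPay v (Function.update μ i σ) i ≤ EVal v (Function.update μ i σ) i →
      EVal v (Function.update μ i σ) i ≤ EVal v μ i

/-- Equilibrium: all strategies admissible, every utility maximizer in `Bu` and
every value maximizer in `Bv` best responds. -/
def Equilibrium (v : Fin n → Fin m → ℝ) (Bu Bv : Finset (Fin n))
    (μ : Fin n → Measure (Fin m → ℝ)) : Prop :=
  (∀ i, Admissible (μ i)) ∧ (∀ i ∈ Bu, UtilBest v μ i) ∧ (∀ i ∈ Bv, ValBest v μ i)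

/-- The rightful winner of auction `j`: the bidder with the highest value,
ties broken toward the smaller index. -/
noncomputable def rwinner [NeZero n] (v : Fin n → Fin m → ℝ) (j : Fin m) : Fin n :=
  (Finset.univ.filter fun i => ∀ i', v i' j ≤ v i j).min' (by
    obtain ⟨i, -, hi⟩ := Finset.exists_max_image (Finset.univ : Finset (Fin n))
      (fun i => v i j) Finset.univ_nonempty
    exact ⟨i, Finset.mem_filter.mpr ⟨Finset.mem_univ _, fun i' => hi i' (Finset.mem_univ _)⟩⟩)

end FPA

open MeasureTheory Finset

namespace FPA

variable {n m : ℕ}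

lemma measurable_bid (i : Fin n) (j : Fin m) :
    Measurable fun b : Fin n → Fin m → ℝ => b i j :=
  (measurable_pi_apply j).comp (measurable_pi_apply i)

lemma measurableSet_wins (v : Fin n → Fin m → ℝ) (j : Fin m) (i : Fin n) :
    MeasurableSet {b | Wins v b j i} := by
  simp only [Wins, Set.ofPred_forall]
  refine MeasurableSet.iInter fun i' => MeasurableSet.iInter fun _ => ?_
  exact (measurableSet_lt (measurable_bid i' j) (measurable_bid i j)).union
    ((measurableSet_eq_fun (measurable_bid i' j) (measurable_bid i j)).inter
      (MeasurableSet.const _))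

lemma measurable_xind (v : Fin n → Fin m → ℝ) (j : Fin m) (i : Fin n) :
    Measurable fun b => xind v b j i :=
  Measurable.ite (measurableSet_wins v j i) measurable_const measurable_const

lemma measurable_valij (v : Fin n → Fin m → ℝ) (i : Fin n) (j : Fin m) :
    Measurable fun b => valij v b i j :=
  (measurable_xind v j i).mul_const _

lemma measurable_payij (v : Fin n → Fin m → ℝ) (i : Fin n) (j : Fin m) :
    Measurable fun b => payij v b i j :=
  (measurable_xind v j i).mul (measurable_bid i j)

lemma xind_nonneg (v b : Fin n → Fin m → ℝ) (j : Fin m) (i : Fin n) : 0 ≤ xind v b j i := by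
  unfold xind; split_ifs <;> norm_num

lemma xind_le_one (v b : Fin n → Fin m → ℝ) (j : Fin m) (i : Fin n) : xind v b j i ≤ 1 := by
  unfold xind; split_ifs <;> norm_num

lemma abs_xind_mul_le (v b : Fin n → Fin m → ℝ) (j : Fin m) (i : Fin n) (c : ℝ) :
    |xind v b j i * c| ≤ |c| := by
  rw [abs_mul, abs_of_nonneg (xind_nonneg v b j i)]
  exact mul_le_of_le_one_left (abs_nonneg c) (xind_le_one v b j i)

lemma exists_wins [NeZero n] (v b : Fin n → Fin m → ℝ) (j : Fin m) : ∃ i, Wins v b j i := by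
  obtain ⟨i, -, hi⟩ := Finset.exists_max_image (Finset.univ : Finset (Fin n))
    (fun i => toLex (b i j, toLex (v i j, OrderDual.toDual i))) Finset.univ_nonempty
  refine ⟨i, fun i' hne => ?_⟩
  have h := hi i' (Finset.mem_univ _)
  simp only [Prod.Lex.toLex_le_toLex, OrderDual.toDual_le_toDual] at h
  rcases h with h | ⟨h, h' | ⟨h', h''⟩⟩
  · exact Or.inl h
  · exact Or.inr ⟨h, Or.inl h'⟩
  · exact Or.inr ⟨h, Or.inr ⟨h', lt_of_le_of_ne h'' hne.symm⟩⟩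

/-- The revenue of an auction is at least every bid placed in it. -/
lemma bid_le_sum_payij [NeZero n] (v b : Fin n → Fin m → ℝ) (j : Fin m)
    (hb : ∀ i, 0 ≤ b i j) (k : Fin n) : b k j ≤ ∑ i, payij v b i j := by
  obtain ⟨w, hw⟩ := exists_wins v b j
  have hle : b k j ≤ b w j := by
    by_cases h : k = w
    · rw [h]
    · rcases hw k h with h' | h'
      · exact h'.le
      · exact h'.1.le
  have hpay : payij v b w j = b w j := by simp [payij, xind, hw]
  calc b k j ≤ payij v b w j := hle.trans_eq hpay.symm
    _ ≤ ∑ i, payij v b i j := Finset.single_le_sum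
        (fun i _ => mul_nonneg (xind_nonneg v b j i) (hb i)) (Finset.mem_univ w)

lemma rwinner_mem [NeZero n] (v : Fin n → Fin m → ℝ) (j : Fin m) :
    rwinner v j ∈ Finset.univ.filter fun i => ∀ i', v i' j ≤ v i j :=
  Finset.min'_mem _ _

lemma le_rwinner [NeZero n] (v : Fin n → Fin m → ℝ) (j : Fin m) (i : Fin n) :
    v i j ≤ v (rwinner v j) j :=
  (Finset.mem_filter.mp (rwinner_mem v j)).2 i

lemma rwinner_le_of_eq [NeZero n] (v : Fin n → Fin m → ℝ) (j : Fin m) (i : Fin n)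
    (h : v i j = v (rwinner v j) j) : rwinner v j ≤ i :=
  Finset.min'_le _ _ (Finset.mem_filter.mpr
    ⟨Finset.mem_univ _, fun i' => h ▸ le_rwinner v j i'⟩)

/-- The rightful winner wins whenever it bids at least as much as everybody else. -/
lemma wins_rwinner [NeZero n] (v b : Fin n → Fin m → ℝ) (j : Fin m)
    (h : ∀ i, b i j ≤ b (rwinner v j) j) : Wins v b j (rwinner v j) := by
  intro i hi
  rcases (h i).lt_or_eq with h' | h'
  · exact Or.inl h'
  · refine Or.inr ⟨h', ?_⟩
    rcases (le_rwinner v j i).lt_or_eq with h'' | h''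
    · exact Or.inl h''
    · exact Or.inr ⟨h'', lt_of_le_of_ne (rwinner_le_of_eq v j i h'') hi.symm⟩

/-- If the rightful winner bids its value, then its value collected plus the original revenue
covers its value. -/
lemma le_valij_update_add_sum_payij [NeZero n] (v b : Fin n → Fin m → ℝ) (j : Fin m)
    (hv : ∀ i j, 0 ≤ v i j) (hb : ∀ i, 0 ≤ b i j) :
    v (rwinner v j) j ≤
      valij v (Function.update b (rwinner v j) (v (rwinner v j))) (rwinner v j) j +
        ∑ i, payij v b i j := by
  set r := rwinner v j with hr
  by_cases h : ∃ k, v r j < b k j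
  · obtain ⟨k, hk⟩ := h
    have h1 := bid_le_sum_payij v b j hb k
    have h2 : 0 ≤ valij v (Function.update b r (v r)) r j :=
      mul_nonneg (xind_nonneg _ _ _ _) (hv _ _)
    linarith
  · push Not at h
    have hw : Wins v (Function.update b r (v r)) j r := by
      refine wins_rwinner v _ j fun i => ?_
      rw [← hr, Function.update_self]
      by_cases hi : i = r
      · subst hi; rw [Function.update_self]
      · rw [Function.update_of_ne hi]; exact h i
    have h1 : valij v (Function.update b r (v r)) r j = v r j := by simp [valij, xind, hw]
    have h2 : 0 ≤ ∑ i, payij v b i j :=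
      Finset.sum_nonneg fun i _ => mul_nonneg (xind_nonneg v b j i) (hb i)
    linarith

lemma map_update_pi (μ : Fin n → Measure (Fin m → ℝ)) [∀ i, IsProbabilityMeasure (μ i)]
    (i : Fin n) (c : Fin m → ℝ) :
    (Measure.pi μ).map (fun b => Function.update b i c) =
      Measure.pi (Function.update μ i (Measure.dirac c)) := by
  let f : Fin n → (Fin m → ℝ) → Fin m → ℝ := Function.update (fun _ => id) i fun _ => c
  have hf : ∀ k, Measurable (f k) := by
    intro k
    by_cases hk : k = i
    · subst hk; simp [f]
    · simp only [f, Function.update_of_ne hk]; exact measurable_id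
  have hmap : ∀ k, (μ k).map (f k) = Function.update μ i (Measure.dirac c) k := by
    intro k
    by_cases hk : k = i
    · subst hk; simp [f, Measure.map_const]
    · simp [f, Function.update_of_ne hk]
  have : ∀ k, IsProbabilityMeasure ((μ k).map (f k)) := fun k =>
    Measure.isProbabilityMeasure_map (hf k).aemeasurable
  have hpi := Measure.pi_map_pi (μ := μ) (f := f) fun k => (hf k).aemeasurable
  rw [funext hmap] at hpi
  rw [← hpi]
  congr 1
  funext b k
  by_cases hk : k = i
  · subst hk; simp [f]
  · simp [f, Function.update_of_ne hk]

lemma integral_pi_update_dirac (μ : Fin n → Measure (Fin m → ℝ))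
    [∀ i, IsProbabilityMeasure (μ i)] (i : Fin n) (c : Fin m → ℝ)
    {g : (Fin n → Fin m → ℝ) → ℝ} (hg : Measurable g) :
    ∫ b, g b ∂Measure.pi (Function.update μ i (Measure.dirac c)) =
      ∫ b, g (Function.update b i c) ∂Measure.pi μ := by
  rw [← map_update_pi μ i c, integral_map (by fun_prop) hg.aestronglyMeasurable]

lemma admissible_dirac {c : Fin m → ℝ} (hc : ∀ j, 0 ≤ c j) : Admissible (Measure.dirac c) := by
  refine ⟨inferInstance, ?_, fun j => ?_⟩
  · rw [ae_dirac_eq]; exact hc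
  · exact integrable_dirac (by simp)

/-- A bidder who bids its value everywhere pays exactly the value it collects. -/
lemma EPay_update_dirac_value (v : Fin n → Fin m → ℝ) (μ : Fin n → Measure (Fin m → ℝ))
    [∀ i, IsProbabilityMeasure (μ i)] (i : Fin n) :
    EPay v (Function.update μ i (Measure.dirac (v i))) i =
      EVal v (Function.update μ i (Measure.dirac (v i))) i := by
  refine Finset.sum_congr rfl fun j _ => ?_
  rw [EPayij, EValij, integral_pi_update_dirac μ i (v i) (measurable_payij v i j),
    integral_pi_update_dirac μ i (v i) (measurable_valij v i j)]
  simp [payij, valij]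

lemma ae_bid_nonneg {μ : Fin n → Measure (Fin m → ℝ)} (hμ : ∀ i, Admissible (μ i)) :
    ∀ᵐ b ∂Measure.pi μ, ∀ i j, 0 ≤ b i j := by
  have : ∀ i, IsProbabilityMeasure (μ i) := fun i => (hμ i).1
  exact ae_all_iff.mpr fun i =>
    (measurePreserving_eval μ i).quasiMeasurePreserving.ae (hμ i).2.1

lemma integrable_payij (v : Fin n → Fin m → ℝ) {μ : Fin n → Measure (Fin m → ℝ)}
    (hμ : ∀ i, Admissible (μ i)) (i : Fin n) (j : Fin m) :
    Integrable (fun b => payij v b i j) (Measure.pi μ) := by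
  have : ∀ i, IsProbabilityMeasure (μ i) := fun i => (hμ i).1
  have hbid : Integrable (fun b : Fin n → Fin m → ℝ => b i j) (Measure.pi μ) :=
    (measurePreserving_eval μ i).integrable_comp_of_integrable ((hμ i).2.2 j)
  exact hbid.mono (measurable_payij v i j).aestronglyMeasurable
    (ae_of_all _ fun b => abs_xind_mul_le v b j i _)

lemma value_rwinner_le [NeZero n] {v : Fin n → Fin m → ℝ} (hv : ∀ i j, 0 ≤ v i j)
    {μ : Fin n → Measure (Fin m → ℝ)} (hμ : ∀ i, Admissible (μ i)) (j : Fin m) :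
    v (rwinner v j) j ≤
      EValij v (Function.update μ (rwinner v j) (Measure.dirac (v (rwinner v j))))
        (rwinner v j) j + ∑ i, EPayij v μ i j := by
  have : ∀ i, IsProbabilityMeasure (μ i) := fun i => (hμ i).1
  set r := rwinner v j
  have hval : Integrable (fun b => valij v (Function.update b r (v r)) r j) (Measure.pi μ) :=
    (integrable_const (v r j)).mono
      ((measurable_valij v r j).comp (by fun_prop)).aestronglyMeasurable
      (ae_of_all _ fun b => abs_xind_mul_le v _ j r _)
  have hpay : Integrable (fun b => ∑ i, payij v b i j) (Measure.pi μ) :=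
    integrable_finsetSum _ fun i _ => integrable_payij v hμ i j
  simp only [EPayij, EValij]
  rw [integral_pi_update_dirac μ r (v r) (measurable_valij v r j),
    ← integral_finsetSum _ fun i _ => integrable_payij v hμ i j, ← integral_add hval hpay]
  calc v r j = ∫ _, v r j ∂Measure.pi μ := by simp
    _ ≤ _ := integral_mono_ae (integrable_const _) (hval.add hpay) (by
      filter_upwards [ae_bid_nonneg hμ] with b hb
      exact le_valij_update_add_sum_payij v b j hv fun i => hb i j)

lemma EValij_nonneg {v : Fin n → Fin m → ℝ} (hv : ∀ i j, 0 ≤ v i j)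
    (μ : Fin n → Measure (Fin m → ℝ)) (i : Fin n) (j : Fin m) : 0 ≤ EValij v μ i j :=
  integral_nonneg fun b => mul_nonneg (xind_nonneg v b j i) (hv i j)

end FPA

/-- Lemma 2 of the paper. In any equilibrium of the first-price
auction, the total value of the value maximizers plus the total payment made in
auctions whose rightful winner is a value maximizer is at least the optimal welfare
of those auctions. -/
theorem fpa_value_maximizer_lemma {n m : ℕ} [NeZero n]
    (v : Fin n → Fin m → ℝ) (hv : ∀ i j, 0 ≤ v i j)
    (Bu Bv : Finset (Fin n)) (hdisj : Disjoint Bu Bv) (hcover : Bu ∪ Bv = Finset.univ)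
    (μ : Fin n → Measure (Fin m → ℝ))
    (heq : FPA.Equilibrium v Bu Bv μ) :
    (∑ i ∈ Bv, FPA.EVal v μ i) +
        ∑ i : Fin n, ∑ j ∈ Finset.univ.filter (fun j => FPA.rwinner v j ∈ Bv),
          FPA.EPayij v μ i j ≥
      ∑ j ∈ Finset.univ.filter (fun j => FPA.rwinner v j ∈ Bv),
        Finset.univ.sup' Finset.univ_nonempty fun i => v i j := by
  obtain ⟨hadm, -, hval⟩ := heq
  have : ∀ i, IsProbabilityMeasure (μ i) := fun i => (hadm i).1
  set S := Finset.univ.filter fun j => FPA.rwinner v j ∈ Bv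
  let D : Fin n → Fin n → Measure (Fin m → ℝ) :=
    fun i => Function.update μ i (Measure.dirac (v i))
  have hdev : ∀ i ∈ Bv,
      ∑ j ∈ S with FPA.rwinner v j = i, FPA.EValij v (D (FPA.rwinner v j)) (FPA.rwinner v j) j ≤
        FPA.EVal v μ i := by
    intro i hi
    calc _ = ∑ j ∈ S with FPA.rwinner v j = i, FPA.EValij v (D i) i j :=
          Finset.sum_congr rfl fun j hj => by rw [(Finset.mem_filter.mp hj).2]
      _ ≤ FPA.EVal v (D i) i := Finset.sum_le_sum_of_subset_of_nonneg
          (Finset.subset_univ _) fun j _ _ => FPA.EValij_nonneg hv _ i j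
      _ ≤ FPA.EVal v μ i := (hval i hi).2 _ (FPA.admissible_dirac (hv i))
          (FPA.EPay_update_dirac_value v μ i).le
  rw [ge_iff_le, Finset.sum_comm]
  calc ∑ j ∈ S, Finset.univ.sup' Finset.univ_nonempty (fun i => v i j)
      ≤ ∑ j ∈ S, (FPA.EValij v (D (FPA.rwinner v j)) (FPA.rwinner v j) j +
          ∑ i, FPA.EPayij v μ i j) := Finset.sum_le_sum fun j _ =>
        (Finset.sup'_le _ _ fun i _ => FPA.le_rwinner v j i).trans
          (FPA.value_rwinner_le hv hadm j)
    _ = (∑ i ∈ Bv, ∑ j ∈ S with FPA.rwinner v j = i,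
          FPA.EValij v (D (FPA.rwinner v j)) (FPA.rwinner v j) j) +
          ∑ j ∈ S, ∑ i, FPA.EPayij v μ i j := by
        rw [Finset.sum_add_distrib, Finset.sum_fiberwise_of_maps_to
          fun j hj => (Finset.mem_filter.mp hj).2]
    _ ≤ _ := by gcongr with i hi; exact hdev i hi
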